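/- If G is a connected locally Dirac graph with maximum degree at most 11, then G is fully cycle extendable; in particular, G is Hamiltonian and pancyclic. -/

import Mathlib

noncomputable def locDeg {V : Type*} (G : SimpleGraph V) (v u : V) : ℕ :=
  (G.neighborSet v ∩ G.neighborSet u).ncard

noncomputable def degN {V : Type*} (G : SimpleGraph V) (v : V) : ℕ :=
  (G.neighborSet v).ncard

def LocallyDirac {V : Type*} (G : SimpleGraph V) : Prop :=
  ∀ v u : V, G.Adj v u → degN G v ≤ 2 * locDeg G v u

/-- `v : ZMod t → V` lists the vertices of a cycle of length `t ≥ 3` in `G`. -/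
def IsCycleFun {V : Type*} (G : SimpleGraph V) (t : ℕ) (v : ZMod t → V) : Prop :=
  3 ≤ t ∧ Function.Injective v ∧ ∀ i : ZMod t, G.Adj (v i) (v (i + 1))

/-- The cycle `v` is extendable: there is a cycle through all vertices of `v` plus exactly
one new vertex. -/
def CycleExtendable {V : Type*} (G : SimpleGraph V) (t : ℕ) (v : ZMod t → V) : Prop :=
  ∃ x ∉ Set.range v, ∃ w : ZMod (t + 1) → V,
    IsCycleFun G (t + 1) w ∧ Set.range w = insert x (Set.range v)

/-- A sequence of `n` vertices that closes up to a cycle, read as a function on `ZMod n`. -/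
theorem isCycleFun_of_nat {V : Type*} {G : SimpleGraph V} {n : ℕ} (hn : 3 ≤ n) (f : ℕ → V)
    (hinj : ∀ i < n, ∀ j < n, f i = f j → i = j)
    (hadj : ∀ i, i + 1 < n → G.Adj (f i) (f (i + 1))) (hlast : G.Adj (f (n - 1)) (f 0)) :
    IsCycleFun G n (fun i => f i.val) := by
  have : NeZero n := ⟨by omega⟩
  have : Fact (1 < n) := ⟨by omega⟩
  refine ⟨hn, fun i j h => ZMod.val_injective n
    (hinj _ (ZMod.val_lt i) _ (ZMod.val_lt j) h), fun i => ?_⟩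
  have hi := ZMod.val_lt i
  have h1 : (i + 1).val = (i.val + 1) % n := by rw [ZMod.val_add, ZMod.val_one]
  change G.Adj (f i.val) (f (i + 1).val)
  rw [h1]
  by_cases h : i.val + 1 < n
  · rw [Nat.mod_eq_of_lt h]
    exact hadj _ h
  · have h2 : i.val = n - 1 := by omega
    rw [h2, show n - 1 + 1 = n by omega, Nat.mod_self]
    exact hlast

/-- A vertex `x` off the cycle, adjacent to two cycle vertices whose successors are adjacent,
can be inserted by reversing the arc between them. -/
theorem IsCycleFun.extendable_of_adj_succ {V : Type*} {G : SimpleGraph V} {t : ℕ}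
    {v : ZMod t → V} (hv : IsCycleFun G t v) {x : V} (hx : x ∉ Set.range v) (a : ZMod t) (m : ℕ)
    (hm : 1 ≤ m) (hmt : m < t) (hxa : G.Adj x (v a)) (hxb : G.Adj x (v (a + m)))
    (hab : G.Adj (v (a + 1)) (v (a + m + 1))) : CycleExtendable G t v := by
  obtain ⟨h3, hinj, hadj⟩ := hv
  have : NeZero t := ⟨by omega⟩
  obtain ⟨g, hg⟩ : ∃ g : ℕ → V, ∀ k : ℕ, g k = v (a + k) := ⟨_, fun _ => rfl⟩
  have hgadj : ∀ k, G.Adj (g k) (g (k + 1)) := fun k => by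
    rw [hg, hg]
    push_cast
    rw [← add_assoc]
    exact hadj _
  have hginj : ∀ i j, 1 ≤ i → i ≤ t → 1 ≤ j → j ≤ t → g i = g j → i = j := by
    intro i j hi hi' hj hj' h
    rw [hg, hg] at h
    have h1 := add_left_cancel (hinj h)
    rw [ZMod.natCast_eq_natCast_iff'] at h1
    rcases hi'.lt_or_eq with h2 | rfl <;> rcases hj'.lt_or_eq with h4 | h4
    · rwa [Nat.mod_eq_of_lt h2, Nat.mod_eq_of_lt h4] at h1
    · rw [Nat.mod_eq_of_lt h2, h4, Nat.mod_self] at h1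
      omega
    · rw [Nat.mod_eq_of_lt h4, Nat.mod_self] at h1
      omega
    · exact h4.symm
  have hgx : ∀ k, g k ≠ x := fun k h => hx ⟨_, (hg k).symm.trans h⟩
  have hgt : g t = v a := by simp [hg]
  have hgm : g m = v (a + m) := hg m
  have hg1 : G.Adj (g 1) (g (m + 1)) := by
    rw [hg, hg]
    push_cast
    rwa [← add_assoc]
  have hgsurj : ∀ i, ∃ k, 1 ≤ k ∧ k ≤ t ∧ g k = v i := by
    intro i
    by_cases h : (i - a).val = 0
    · refine ⟨t, by omega, le_rfl, ?_⟩
      rw [ZMod.val_eq_zero, sub_eq_zero] at h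
      rw [hgt, h]
    · refine ⟨(i - a).val, by omega, (ZMod.val_lt _).le, ?_⟩
      rw [hg, ZMod.natCast_zmod_val, add_sub_cancel]
  obtain ⟨f, hf1, hf2, hf3⟩ : ∃ f : ℕ → V, (∀ k < m, f k = g (m - k)) ∧
      (∀ k, m ≤ k → k < t → f k = g (k + 1)) ∧ f t = x :=
    ⟨fun k => if k < m then g (m - k) else if k < t then g (k + 1) else x,
      fun k h => by simp [h], fun k h h' => by simp [h.not_gt, h'], by simp [hmt.not_gt]⟩
  have hfg : ∀ k < t, ∃ j, 1 ≤ j ∧ j ≤ t ∧ f k = g j ∧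
      ((k < m ∧ j = m - k) ∨ (m ≤ k ∧ j = k + 1)) := by
    intro k hk
    by_cases h : k < m
    · exact ⟨m - k, by omega, by omega, hf1 k h, by omega⟩
    · exact ⟨k + 1, by omega, by omega, hf2 k (by omega) hk, by omega⟩
  refine ⟨x, hx, fun i => f i.val, isCycleFun_of_nat (by omega) f ?_ ?_ ?_, ?_⟩
  · intro i hi j hj h
    rcases (Nat.lt_succ_iff.1 hi).lt_or_eq with hi | rfl <;>
      rcases (Nat.lt_succ_iff.1 hj).lt_or_eq with hj | hj
    · obtain ⟨p, hp1, hp2, hp, hp'⟩ := hfg i hi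
      obtain ⟨q, hq1, hq2, hq, hq'⟩ := hfg j hj
      have := hginj p q hp1 hp2 hq1 hq2 (hp.symm.trans (h.trans hq))
      omega
    · obtain ⟨p, -, -, hp, -⟩ := hfg i hi
      rw [hj, hf3, hp] at h
      exact (hgx _ h).elim
    · obtain ⟨q, -, -, hq, -⟩ := hfg j hj
      rw [hf3, hq] at h
      exact (hgx _ h.symm).elim
    · exact hj.symm
  · intro i hi
    rcases (Nat.lt_succ_iff.1 hi : i + 1 ≤ t).lt_or_eq with hi | hi
    · rcases lt_trichotomy (i + 1) m with h | h | h
      · rw [hf1 i (by omega), hf1 _ h, show m - i = m - (i + 1) + 1 by omega]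
        exact (hgadj _).symm
      · rw [hf1 i (by omega), hf2 _ h.ge hi, show m - i = 1 by omega, h]
        exact hg1
      · rw [hf2 i (by omega) (by omega), hf2 _ h.le hi]
        exact hgadj _
    · rw [hf2 i (by omega) (by omega), hi, hf3, hgt]
      exact hxa.symm
  · rw [Nat.add_sub_cancel, hf3, hf1 0 (by omega), Nat.sub_zero, hgm]
    exact hxb
  · ext y
    constructor
    · rintro ⟨i, rfl⟩
      rcases (Nat.lt_succ_iff.1 (ZMod.val_lt i)).lt_or_eq with h | h
      · obtain ⟨p, -, -, hp, -⟩ := hfg _ h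
        exact Or.inr ⟨_, (hg p).symm.trans hp.symm⟩
      · left
        change f i.val = x
        rw [h, hf3]
    · have hval : ∀ k ≤ t, f k ∈ Set.range fun i : ZMod (t + 1) => f i.val := fun k hk =>
        ⟨(k : ZMod (t + 1)), by
          change f (k : ZMod (t + 1)).val = f k
          rw [ZMod.val_natCast_of_lt (by omega)]⟩
      rintro (rfl | ⟨i, rfl⟩)
      · exact hf3 ▸ hval t le_rfl
      · obtain ⟨k, hk1, hk2, hk⟩ := hgsurj i
        rw [← hk]
        by_cases h : k ≤ m
        · have := hval (m - k) (by omega)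
          rwa [hf1 _ (by omega), Nat.sub_sub_self h] at this
        · have := hval (k - 1) (by omega)
          rwa [hf2 _ (by omega) (by omega), Nat.sub_add_cancel hk1] at this

/-- A vertex adjacent to two consecutive cycle vertices can be inserted between them. -/
theorem IsCycleFun.extendable_of_adj_consecutive {V : Type*} {G : SimpleGraph V} {t : ℕ}
    {v : ZMod t → V} (hv : IsCycleFun G t v) {x : V} (hx : x ∉ Set.range v) (a : ZMod t)
    (hxa : G.Adj x (v a)) (hxb : G.Adj x (v (a + 1))) : CycleExtendable G t v :=
  hv.extendable_of_adj_succ hx a 1 le_rfl (by have := hv.1; omega) hxa (by simpa using hxb)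
    (by simpa using hv.2.2 (a + 1))

open Classical in
/-- In a locally Dirac graph, two nonadjacent neighbours of `w` have at least as many common
neighbours in the neighbourhood of `w` as there are vertices of it adjacent to neither. -/
theorem LocallyDirac.card_le_card_inter {V : Type*} [Fintype V] {G : SimpleGraph V}
    (hLD : LocallyDirac G) {w x y : V} (hx : G.Adj w x) (hy : G.Adj w y) (E : Finset V)
    (hE : ∀ z ∈ E, G.Adj w z ∧ ¬ G.Adj x z ∧ ¬ G.Adj y z) :
    E.card ≤ (Finset.univ.filter fun z => G.Adj w z ∧ G.Adj x z ∧ G.Adj y z).card := by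
  have key : ∀ u, G.Adj w u → (Finset.univ.filter fun z => G.Adj w z).card ≤
      2 * (Finset.univ.filter fun z => G.Adj w z ∧ G.Adj u z).card := by
    intro u hu
    have h := hLD w u hu
    rwa [degN, locDeg, Set.ncard_eq_toFinset_card', Set.ncard_eq_toFinset_card',
      show (G.neighborSet w).toFinset = Finset.univ.filter fun z => G.Adj w z by ext; simp,
      show (G.neighborSet w ∩ G.neighborSet u).toFinset =
        Finset.univ.filter fun z => G.Adj w z ∧ G.Adj u z by ext; simp] at h
  have hA := key x hx
  have hB := key y hy
  set A := Finset.univ.filter fun z => G.Adj w z ∧ G.Adj x z with hAdef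
  set B := Finset.univ.filter fun z => G.Adj w z ∧ G.Adj y z with hBdef
  have hAB : (Finset.univ.filter fun z => G.Adj w z ∧ G.Adj x z ∧ G.Adj y z) = A ∩ B := by
    ext z
    simp only [hAdef, hBdef, Finset.mem_filter, Finset.mem_inter, Finset.mem_univ, true_and]
    tauto
  have hdisj : Disjoint (A ∪ B) E := by
    rw [Finset.disjoint_left]
    intro z hz hzE
    have := hE z hzE
    simp only [hAdef, hBdef, Finset.mem_filter, Finset.mem_union, Finset.mem_univ,
      true_and] at hz
    tauto
  have hsub : (A ∪ B) ∪ E ⊆ Finset.univ.filter fun z => G.Adj w z := by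
    intro z hz
    simp only [hAdef, hBdef, Finset.mem_filter, Finset.mem_union, Finset.mem_univ,
      true_and] at hz ⊢
    rcases hz with (h | h) | h
    exacts [h.1, h.1, (hE z h).1]
  have h1 := Finset.card_le_card hsub
  rw [Finset.card_union_of_disjoint hdisj] at h1
  have h2 := Finset.card_union_add_card_inter A B
  rw [hAB]
  omega

open Classical in
/-- In a locally Dirac graph, a cycle with a neighbour outside it is extendable. -/
theorem LocallyDirac.cycleExtendable {V : Type*} [Fintype V] {G : SimpleGraph V}
    (hLD : LocallyDirac G) {t : ℕ} {v : ZMod t → V} (hv : IsCycleFun G t v) {x : V}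
    (hx : x ∉ Set.range v) {i₀ : ZMod t} (hxi : G.Adj x (v i₀)) : CycleExtendable G t v := by
  by_contra hne
  have h3 := hv.1
  have : NeZero t := ⟨by omega⟩
  have hcons : ∀ y ∉ Set.range v, ∀ i, G.Adj y (v i) → ¬ G.Adj y (v (i + 1)) :=
    fun y hy i h h' => hne (hv.extendable_of_adj_consecutive hy i h h')
  have hsucc : ∀ i j, G.Adj x (v i) → G.Adj x (v j) → ¬ G.Adj (v (i + 1)) (v (j + 1)) := by
    intro i j hi hj h
    have hij : i ≠ j := fun e => h.ne (by rw [e])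
    have hpos : (j - i).val ≠ 0 := by
      rw [Ne, ZMod.val_eq_zero, sub_eq_zero]
      exact hij.symm
    have e : i + ((j - i).val : ZMod t) = j := by rw [ZMod.natCast_zmod_val, add_sub_cancel]
    exact hne (hv.extendable_of_adj_succ hx i (j - i).val (by omega) (ZMod.val_lt _) hi
      (by rwa [e]) (by rwa [e]))
  set W : Finset (ZMod t) := Finset.univ.filter fun i => G.Adj x (v i) with hW
  have hWmem : ∀ i, i ∈ W ↔ G.Adj x (v i) := fun i => by simp [hW]
  have key : ∀ i ∈ W, (W.filter fun j => G.Adj (v i) (v (j + 1))).card <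
      (W.filter fun j => G.Adj (v j) (v (i + 1))).card := by
    intro i hi
    rw [hWmem] at hi
    set F := W.filter fun j => G.Adj (v i) (v (j + 1)) with hF
    have hxF : x ∉ F.image fun j => v (j + 1) := by
      intro h
      obtain ⟨j, -, hj⟩ := Finset.mem_image.1 h
      exact hx ⟨_, hj⟩
    have hcard : (insert x (F.image fun j => v (j + 1))).card = F.card + 1 := by
      rw [Finset.card_insert_of_notMem hxF, Finset.card_image_of_injective]
      intro j k h
      exact add_right_cancel (hv.2.1 h)
    have h1 := hLD.card_le_card_inter hi.symm (hv.2.2 i) (insert x (F.image fun j => v (j + 1)))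
      (by
        intro z hz
        rcases Finset.mem_insert.1 hz with rfl | hz
        · exact ⟨hi.symm, G.irrefl, fun h => hcons _ hx i hi h.symm⟩
        · obtain ⟨j, hj, rfl⟩ := Finset.mem_image.1 hz
          rw [hF, Finset.mem_filter, hWmem] at hj
          exact ⟨hj.2, hcons x hx j hj.1, hsucc i j hi hj.1⟩)
    have h2 : (Finset.univ.filter fun z =>
          G.Adj (v i) z ∧ G.Adj x z ∧ G.Adj (v (i + 1)) z).card ≤
        (W.filter fun j => G.Adj (v j) (v (i + 1))).card := by
      refine le_trans (Finset.card_le_card ?_) (Finset.card_image_le (f := v))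
      intro z hz
      obtain ⟨hz1, hz2, hz3⟩ := (Finset.mem_filter.1 hz).2
      by_cases hzv : z ∈ Set.range v
      · obtain ⟨j, rfl⟩ := hzv
        exact Finset.mem_image_of_mem _ (Finset.mem_filter.2 ⟨(hWmem j).2 hz2, hz3.symm⟩)
      · exact (hcons z hzv i hz1.symm hz3.symm).elim
    omega
  have hlt := Finset.sum_lt_sum_of_nonempty ⟨i₀, (hWmem i₀).2 hxi⟩ key
  simp only [Finset.card_filter] at hlt
  rw [Finset.sum_comm] at hlt
  exact lt_irrefl _ hlt

/-- In a connected locally Dirac graph every non-Hamiltonian cycle is extendable. -/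
theorem LocallyDirac.cycleExtendable_of_range_ne_univ {V : Type*} [Fintype V]
    {G : SimpleGraph V} (hLD : LocallyDirac G) (hc : G.Connected) {t : ℕ} {v : ZMod t → V}
    (hv : IsCycleFun G t v) (hr : Set.range v ≠ Set.univ) : CycleExtendable G t v := by
  obtain ⟨y, hy⟩ := (Set.ne_univ_iff_exists_notMem _).1 hr
  obtain ⟨p⟩ := hc.preconnected (v 0) y
  obtain ⟨d, -, ⟨i, hi⟩, hd⟩ := p.exists_boundary_dart (Set.range v) ⟨0, rfl⟩ hy
  exact hLD.cycleExtendable hv hd (i₀ := i) (hi ▸ d.adj.symm)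

/-- In a connected locally Dirac graph with at least two vertices, every vertex lies on a
triangle. -/
theorem LocallyDirac.exists_triangle {V : Type*} [Fintype V] {G : SimpleGraph V}
    (hLD : LocallyDirac G) (hc : G.Connected) (hV : 1 < Fintype.card V) (x : V) :
    ∃ a b : V, G.Adj x a ∧ G.Adj x b ∧ G.Adj a b := by
  have := Fintype.one_lt_card_iff_nontrivial.1 hV
  obtain ⟨a, ha⟩ := hc.preconnected.exists_adj_of_nontrivial x
  have hpos : 0 < degN G x := (Set.ncard_pos (Set.toFinite _)).2 ⟨a, ha⟩
  have h := hLD x a ha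
  obtain ⟨b, hb⟩ := (Set.ncard_pos (Set.toFinite _)).1 (show 0 < locDeg G x a by omega)
  exact ⟨a, b, ha, hb.1, hb.2⟩

/-- A connected locally Dirac graph on at least three vertices is pancyclic. -/
theorem LocallyDirac.exists_isCycleFun {V : Type*} [Fintype V] {G : SimpleGraph V}
    (hLD : LocallyDirac G) (hc : G.Connected) (l : ℕ) (hl : 3 ≤ l) (hlV : l ≤ Fintype.card V) :
    ∃ w : ZMod l → V, IsCycleFun G l w := by
  induction l, hl using Nat.le_induction with
  | base =>
    obtain ⟨x⟩ := hc.nonempty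
    obtain ⟨a, b, hxa, hxb, hab⟩ := hLD.exists_triangle hc (by omega) x
    refine ⟨_, isCycleFun_of_nat le_rfl
      (fun k => if k = 0 then x else if k = 1 then a else b) ?_ ?_ ?_⟩
    · have h1 := hxa.ne
      have h2 := hxb.ne
      have h4 := hab.ne
      intro i hi j hj
      interval_cases i <;> interval_cases j <;> simp [h1, h2, h4, h1.symm, h2.symm, h4.symm]
    · intro i hi
      have : i < 2 := by omega
      interval_cases i <;> simp [hxa, hab]
    · simpa using hxb.symm
  | succ l hl ih =>
    obtain ⟨v, hv⟩ := ih (by omega)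
    have : NeZero l := ⟨by omega⟩
    have hr : Set.range v ≠ Set.univ := by
      intro h
      have := Fintype.card_le_of_surjective v (Set.range_eq_univ.1 h)
      rw [ZMod.card] at this
      omega
    obtain ⟨_, _, w, hw, _⟩ := hLD.cycleExtendable_of_range_ne_univ hc hv hr
    exact ⟨w, hw⟩

/-- A connected locally Dirac graph with maximum degree at most 11 is fully cycle
extendable (every vertex lies on a triangle and every non-Hamiltonian cycle extends);
in particular it is Hamiltonian and pancyclic. -/
theorem stmt17 {V : Type*} [Fintype V] (G : SimpleGraph V) (hc : G.Connected)
    (hLD : LocallyDirac G) (h3 : 3 ≤ Fintype.card V)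
    (hDelta : ∀ x : V, degN G x ≤ 11) :
    ((∀ x : V, ∃ a b : V, G.Adj x a ∧ G.Adj x b ∧ G.Adj a b) ∧
      (∀ (t : ℕ) (v : ZMod t → V), IsCycleFun G t v → Set.range v ≠ Set.univ →
        CycleExtendable G t v)) ∧
    (∃ w : ZMod (Fintype.card V) → V, IsCycleFun G (Fintype.card V) w) ∧
    (∀ l : ℕ, 3 ≤ l → l ≤ Fintype.card V → ∃ w : ZMod l → V, IsCycleFun G l w) := by
  exact ⟨⟨hLD.exists_triangle hc (by omega),
    fun _ _ hv hr => hLD.cycleExtendable_of_range_ne_univ hc hv hr⟩,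
    hLD.exists_isCycleFun hc _ h3 le_rfl, hLD.exists_isCycleFun hc⟩
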